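/- For every preference profile P, A^{F*}(P) is the unique maximizer of Shannon entropy among all budget divisions that maximize social welfare for P: A^{F*}(P) maximizes social welfare, and every social-welfare-maximizing division q ≠ A^{F*}(P) satisfies H(q) < H(A^{F*}(P)). -/

import Mathlib

open Finset

/-- `p` is a budget division over `m` alternatives: entries in `[0,1]` summing to `1`. -/
def IsDivision {m : ℕ} (p : Fin m → ℝ) : Prop :=
  (∀ j, p j ∈ Set.Icc (0 : ℝ) 1) ∧ ∑ j, p j = 1

/-- A valid preference profile: every voter reports a budget division. -/
def IsProfile {n m : ℕ} (P : Fin n → Fin m → ℝ) : Prop :=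
  ∀ i, IsDivision (P i)

/-- The ℓ1 distance between two vectors. -/
noncomputable def l1 {m : ℕ} (x y : Fin m → ℝ) : ℝ := ∑ j, |x j - y j|

/-- Median of a list of odd length `2k+1`: its `(k+1)`-st smallest element. -/
noncomputable def medList (l : List ℝ) : ℝ :=
  ((Multiset.ofList l).sort (· ≤ ·)).getD ((l.length - 1) / 2) 0

/-- Coordinate-wise generalized median on alternative `j`, with phantoms `f k t` and
the voters' reports on alternative `j`. -/
noncomputable def phMed {n m : ℕ} (f : Fin (n + 1) → ℝ → ℝ)
    (P : Fin n → Fin m → ℝ) (t : ℝ) (j : Fin m) : ℝ :=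
  medList (List.ofFn (fun k => f k t) ++ List.ofFn (fun i => P i j))

/-- A phantom system for `n` voters: `n+1` continuous, weakly increasing functions
`[0,1] → [0,1]` with `f k 0 = 0`, `f k 1 = 1`, ordered `f 0 ≥ f 1 ≥ ⋯ ≥ f n`. -/
structure IsPhantomSystem (n : ℕ) (f : Fin (n + 1) → ℝ → ℝ) : Prop where
  cont : ∀ k, ContinuousOn (f k) (Set.Icc 0 1)
  mono : ∀ k, MonotoneOn (f k) (Set.Icc 0 1)
  mem_Icc : ∀ k, ∀ t ∈ Set.Icc (0 : ℝ) 1, f k t ∈ Set.Icc (0 : ℝ) 1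
  apply_zero : ∀ k, f k 0 = 0
  apply_one : ∀ k, f k 1 = 1
  ordered : ∀ t ∈ Set.Icc (0 : ℝ) 1, ∀ k l : Fin (n + 1), k ≤ l → f l t ≤ f k t

/-- The normalizing time `t*` at which the coordinate-wise medians sum to `1`. -/
noncomputable def tStar {n m : ℕ} (f : Fin (n + 1) → ℝ → ℝ)
    (P : Fin n → Fin m → ℝ) : ℝ :=
  sInf {t | t ∈ Set.Icc (0 : ℝ) 1 ∧ ∑ j, phMed f P t j = 1}

/-- The moving phantom mechanism `A^F` defined by the phantom family `f`. -/
noncomputable def AMP {n m : ℕ} (f : Fin (n + 1) → ℝ → ℝ)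
    (P : Fin n → Fin m → ℝ) : Fin m → ℝ :=
  fun j => phMed f P (tStar f P) j

/-- The independent-markets phantom system for `n` voters: `f k t = min (t(n-k)) 1`. -/
noncomputable def fIM (n : ℕ) : Fin (n + 1) → ℝ → ℝ :=
  fun k t => min (t * ((n : ℝ) - (k : ℝ))) 1

/-- The phantom system `F*` for `n` voters, in which the phantoms move to 1 one at a time. -/
noncomputable def fStar (n : ℕ) : Fin (n + 1) → ℝ → ℝ :=
  fun k t => max 0 (min 1 (t * ((n : ℝ) + 1) - (k : ℝ)))

/-- The `j`-th standard unit vector in `ℝ^m`. -/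
def unitVec (m : ℕ) (j : Fin m) : Fin m → ℝ := fun k => if k = j then 1 else 0

/-- Incentive compatibility under ℓ1 preferences. -/
def IncentiveCompatible {n m : ℕ} (A : (Fin n → Fin m → ℝ) → (Fin m → ℝ)) : Prop :=
  ∀ P : Fin n → Fin m → ℝ, IsProfile P → ∀ i : Fin n,
    ∀ ptrue pmis : Fin m → ℝ, IsDivision ptrue → IsDivision pmis →
      l1 (A (Function.update P i ptrue)) ptrue ≤ l1 (A (Function.update P i pmis)) ptrue

/-- Anonymity: the output is invariant under permutations of the voters. -/
def Anonymous {n m : ℕ} (A : (Fin n → Fin m → ℝ) → (Fin m → ℝ)) : Prop :=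
  ∀ P : Fin n → Fin m → ℝ, IsProfile P → ∀ σ : Equiv.Perm (Fin n), A (P ∘ σ) = A P

/-- Neutrality: permuting the alternatives in all reports permutes the output likewise. -/
def Neutral {n m : ℕ} (A : (Fin n → Fin m → ℝ) → (Fin m → ℝ)) : Prop :=
  ∀ P : Fin n → Fin m → ℝ, IsProfile P → ∀ σ : Equiv.Perm (Fin m),
    A (fun i j => P i (σ j)) = fun j => A P (σ j)

/-- Proportionality: on single-minded profiles, alternative `j` gets `n_j / n`. -/
def Proportional {n m : ℕ} (A : (Fin n → Fin m → ℝ) → (Fin m → ℝ)) : Prop :=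
  ∀ P : Fin n → Fin m → ℝ, (∀ i, ∃ j, P i = unitVec m j) →
    ∀ j, A P j = (Nat.card {i : Fin n // P i = unitVec m j} : ℝ) / (n : ℝ)

/-- Pareto optimality. -/
def ParetoOptimal {n m : ℕ} (A : (Fin n → Fin m → ℝ) → (Fin m → ℝ)) : Prop :=
  ∀ P : Fin n → Fin m → ℝ, IsProfile P → ∀ q : Fin m → ℝ, IsDivision q →
    (∃ i, l1 q (P i) < l1 (A P) (P i)) → ∃ i, l1 (A P) (P i) < l1 q (P i)

/-- A mechanism is valid if it maps profiles to budget divisions. -/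
def ValidMech {n m : ℕ} (A : (Fin n → Fin m → ℝ) → (Fin m → ℝ)) : Prop :=
  ∀ P, IsProfile P → IsDivision (A P)

/-- `q` maximizes (utilitarian) social welfare for `P`, i.e. minimizes total ℓ1 distance. -/
def MaximizesWelfare {n m : ℕ} (P : Fin n → Fin m → ℝ) (q : Fin m → ℝ) : Prop :=
  IsDivision q ∧ ∀ q' : Fin m → ℝ, IsDivision q' → ∑ i, l1 (P i) q ≤ ∑ i, l1 (P i) q'

/-- The `k`-th largest entry of `v` (1-indexed); `0` when `k > n`. -/
noncomputable def kthLargest {n : ℕ} (v : Fin n → ℝ) (k : ℕ) : ℝ :=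
  (((Multiset.ofList (List.ofFn v)).sort (· ≤ ·)).reverse).getD (k - 1) 0

lemma aux_countP_ofFn (p : ℝ → Prop) [DecidablePred p] (n : ℕ) (v : Fin n → ℝ) :
    (List.ofFn v).countP (fun x => decide (p x)) = (univ.filter fun i => p (v i)).card := by
  induction n with
  | zero => simp
  | succ k ih =>
    rw [List.ofFn_succ, List.countP_cons, ih, Finset.card_filter, Finset.card_filter,
      Fin.sum_univ_succ]
    simp [add_comm]

lemma aux_med (n : ℕ) (l : List ℝ) (hl : l.length = 2 * n + 1) :
    l.countP (fun x => decide (x < medList l)) ≤ n ∧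
    l.countP (fun x => decide (medList l < x)) ≤ n := by
  obtain ⟨L, hL⟩ : ∃ L, L = (Multiset.ofList l).sort (· ≤ ·) := ⟨_, rfl⟩
  have hperm : L.Perm l := by
    rw [← Multiset.coe_eq_coe, hL, Multiset.sort_eq]
  have hsort : L.Pairwise (· ≤ ·) := by rw [hL]; exact Multiset.pairwise_sort _ _
  have hlen : L.length = 2 * n + 1 := by rw [hperm.length_eq, hl]
  have hn : n < L.length := by omega
  have hm : medList l = L[n] := by
    unfold medList
    rw [← hL, hl]
    have : (2 * n + 1 - 1) / 2 = n := by omega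
    rw [this, List.getD_eq_getElem _ _ hn]
  rw [hm]
  have hmono : ∀ i j (hi : i < L.length) (hj : j < L.length), i ≤ j → L[i] ≤ L[j] := by
    intro i j hi hj hij
    exact hsort.rel_get_of_le (a := ⟨i, hi⟩) (b := ⟨j, hj⟩) hij
  constructor
  · rw [← hperm.countP_eq]
    have h0 : List.countP (fun x => decide (x < L[n])) L =
        List.countP (fun x => decide (x < L[n])) (L.take n) +
        List.countP (fun x => decide (x < L[n])) (L.drop n) := by
      rw [← List.countP_append, List.take_append_drop]
    have h1 : List.countP (fun x => decide (x < L[n])) (L.drop n) = 0 := by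
      rw [List.countP_eq_zero]
      intro a ha
      obtain ⟨i, hi, rfl⟩ := List.mem_iff_getElem.1 ha
      simp only [List.getElem_drop, decide_eq_true_eq, not_lt]
      exact hmono _ _ _ _ (by omega)
    have h2 : List.countP (fun x => decide (x < L[n])) (L.take n) ≤ n :=
      le_trans List.countP_le_length (by simp)
    omega
  · rw [← hperm.countP_eq]
    have h0 : List.countP (fun x => decide (L[n] < x)) L =
        List.countP (fun x => decide (L[n] < x)) (L.take (n+1)) +
        List.countP (fun x => decide (L[n] < x)) (L.drop (n+1)) := by
      rw [← List.countP_append, List.take_append_drop]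
    have h1 : List.countP (fun x => decide (L[n] < x)) (L.take (n+1)) = 0 := by
      rw [List.countP_eq_zero]
      intro a ha
      obtain ⟨i, hi, rfl⟩ := List.mem_iff_getElem.1 ha
      simp only [List.getElem_take, decide_eq_true_eq, not_lt]
      simp at hi
      exact hmono _ _ _ _ (by omega)
    have h2 : List.countP (fun x => decide (L[n] < x)) (L.drop (n+1)) ≤ n :=
      le_trans List.countP_le_length (by simp; omega)
    omega

lemma aux_phMed {n m : ℕ} (f : Fin (n + 1) → ℝ → ℝ)
    (P : Fin n → Fin m → ℝ) (t : ℝ) (j : Fin m) :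
    (univ.filter fun k => f k t < phMed f P t j).card +
      (univ.filter fun i => P i j < phMed f P t j).card ≤ n ∧
    (univ.filter fun k => phMed f P t j < f k t).card +
      (univ.filter fun i => phMed f P t j < P i j).card ≤ n := by
  have h := aux_med n (List.ofFn (fun k => f k t) ++ List.ofFn (fun i => P i j))
    (by simp; omega)
  simp only [List.countP_append] at h
  rw [show medList (List.ofFn (fun k => f k t) ++ List.ofFn (fun i => P i j)) = phMed f P t j from rfl] at h
  rw [aux_countP_ofFn (fun x => x < phMed f P t j) _ (fun k => f k t),
    aux_countP_ofFn (fun x => x < phMed f P t j) _ (fun i => P i j),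
    aux_countP_ofFn (fun x => phMed f P t j < x) _ (fun k => f k t),
    aux_countP_ofFn (fun x => phMed f P t j < x) _ (fun i => P i j)] at h
  exact h

lemma aux_compl (n : ℕ) (v : Fin n → ℝ) (a : ℝ) :
    (univ.filter fun i => v i ≤ a).card + (univ.filter fun i => a < v i).card = n := by
  have := Finset.card_filter_add_card_filter_not (s := (univ : Finset (Fin n))) (fun i => v i ≤ a)
  simpa using this

lemma aux_compl2 (n : ℕ) (v : Fin n → ℝ) (a : ℝ) :
    (univ.filter fun i => a ≤ v i).card + (univ.filter fun i => v i < a).card = n := by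
  have := Finset.card_filter_add_card_filter_not (s := (univ : Finset (Fin n))) (fun i => a ≤ v i)
  simpa using this

lemma aux_lip {n m : ℕ} (f : Fin (n + 1) → ℝ → ℝ)
    (P : Fin n → Fin m → ℝ) (t t' ε : ℝ) (hε : 0 ≤ ε) (j : Fin m)
    (h : ∀ k, f k t ≤ f k t' + ε) : phMed f P t j ≤ phMed f P t' j + ε := by
  by_contra! hc
  have h1 := (aux_phMed f P t j).1
  have h2 := (aux_phMed f P t' j).2
  have c1 := aux_compl (n+1) (fun k => f k t') (phMed f P t' j)
  have c2 := aux_compl n (fun i => P i j) (phMed f P t' j)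
  have d1 : (univ.filter fun k => f k t' ≤ phMed f P t' j).card ≤
      (univ.filter fun k => f k t < phMed f P t j).card := by
    apply Finset.card_le_card
    intro k
    simp only [Finset.mem_filter, Finset.mem_univ, true_and]
    intro hk
    linarith [h k]
  have d2 : (univ.filter fun i => P i j ≤ phMed f P t' j).card ≤
      (univ.filter fun i => P i j < phMed f P t j).card := by
    apply Finset.card_le_card
    intro k
    simp only [Finset.mem_filter, Finset.mem_univ, true_and]
    intro hk
    linarith
  omega

lemma aux_fStar_lip (n : ℕ) (k : Fin (n+1)) (t t' : ℝ) :
    fStar n k t ≤ fStar n k t' + (n+1) * |t - t'| := by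
  unfold fStar
  have h0 : 0 ≤ ((n:ℝ)+1) * |t - t'| := by positivity
  have h1 : t * ((n:ℝ)+1) - k ≤ t' * ((n:ℝ)+1) - k + ((n:ℝ)+1) * |t - t'| := by
    have := le_abs_self (t - t')
    nlinarith [Nat.cast_nonneg (α := ℝ) n]
  apply max_le
  · linarith [le_max_left 0 (min 1 (t' * ((n:ℝ)+1) - k))]
  · have h2 := le_max_right 0 (min 1 (t' * ((n:ℝ)+1) - k))
    have h3 : min 1 (t * ((n:ℝ)+1) - k) ≤ min 1 (t' * ((n:ℝ)+1) - k) + ((n:ℝ)+1) * |t - t'| := by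
      rw [← min_add_add_right]
      exact min_le_min (by linarith) h1
    linarith

lemma aux_cont {n m : ℕ} (P : Fin n → Fin m → ℝ) (j : Fin m) :
    Continuous (fun t => phMed (fStar n) P t j) := by
  apply LipschitzWith.continuous (K := (n : NNReal) + 1)
  apply LipschitzWith.of_le_add_mul
  intro t t'
  have := aux_lip (fStar n) P t t' ((n+1) * |t - t'|) (by positivity) j
    (fun k => aux_fStar_lip n k t t')
  simpa [Real.dist_eq] using this

lemma aux_fStar_mem (n : ℕ) (k : Fin (n+1)) (t : ℝ) : fStar n k t ∈ Set.Icc (0:ℝ) 1 := by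
  unfold fStar
  exact ⟨le_max_left _ _, max_le zero_le_one (min_le_left _ _)⟩

lemma aux_lower {n m : ℕ} (f : Fin (n + 1) → ℝ → ℝ) (P : Fin n → Fin m → ℝ) (t : ℝ) (j : Fin m)
    (c : ℝ) (h : ∀ k, c ≤ f k t) : c ≤ phMed f P t j := by
  by_contra! hc
  have h2 := (aux_phMed f P t j).2
  have : (univ.filter fun k => phMed f P t j < f k t) = univ := by
    rw [Finset.filter_true_of_mem]
    intro k _
    linarith [h k]
  rw [this, Finset.card_univ, Fintype.card_fin] at h2
  omega

lemma aux_upper {n m : ℕ} (f : Fin (n + 1) → ℝ → ℝ) (P : Fin n → Fin m → ℝ) (t : ℝ) (j : Fin m)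
    (c : ℝ) (h : ∀ k, f k t ≤ c) : phMed f P t j ≤ c := by
  by_contra! hc
  have h2 := (aux_phMed f P t j).1
  have : (univ.filter fun k => f k t < phMed f P t j) = univ := by
    rw [Finset.filter_true_of_mem]
    intro k _
    linarith [h k]
  rw [this, Finset.card_univ, Fintype.card_fin] at h2
  omega

lemma aux_tStar {n m : ℕ} (hm : 2 ≤ m) (P : Fin n → Fin m → ℝ) :
    tStar (fStar n) P ∈ Set.Icc (0:ℝ) 1 ∧ ∑ j, AMP (fStar n) P j = 1 := by
  have hc : Continuous (fun t => ∑ j, phMed (fStar n) P t j) :=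
    continuous_finsetSum _ (fun j _ => aux_cont P j)
  have h0 : ∑ j, phMed (fStar n) P 0 j ≤ 1 := by
    have : ∑ j, phMed (fStar n) P 0 j ≤ ∑ j : Fin m, (0:ℝ) := by
      apply Finset.sum_le_sum
      intro j _
      apply aux_upper
      intro k
      unfold fStar
      apply max_le le_rfl
      apply min_le_of_right_le
      simp
    simp at this
    linarith
  have h1 : 1 ≤ ∑ j, phMed (fStar n) P 1 j := by
    have : ∑ j : Fin m, (1:ℝ) ≤ ∑ j, phMed (fStar n) P 1 j := by
      apply Finset.sum_le_sum
      intro j _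
      apply aux_lower
      intro k
      unfold fStar
      apply le_max_of_le_right
      apply le_min le_rfl
      have : (k:ℝ) ≤ n := by exact_mod_cast Nat.lt_succ_iff.1 k.2
      linarith
    simp at this
    have h2 : (2:ℝ) ≤ m := by exact_mod_cast hm
    linarith
  obtain ⟨t, ht, hts⟩ := intermediate_value_Icc (zero_le_one (α := ℝ)) hc.continuousOn ⟨h0, h1⟩
  have hcl : IsClosed {t | t ∈ Set.Icc (0 : ℝ) 1 ∧ ∑ j, phMed (fStar n) P t j = 1} :=
    isClosed_Icc.inter (isClosed_eq hc continuous_const)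
  have := hcl.csInf_mem ⟨t, ht, hts⟩ ⟨0, fun t ht => ht.1.1⟩
  exact this

/-- The combinatorial facts about the output at one coordinate. -/
lemma aux_struct {n m : ℕ} (P : Fin n → Fin m → ℝ) (hP : IsProfile P) (t : ℝ)
    (ht : t ∈ Set.Icc (0:ℝ) 1) :
    ∃ (K : ℕ) (x : ℝ), 0 ≤ x ∧ K ≤ n ∧ ∀ j, phMed (fStar n) P t j ∈ Set.Icc (0:ℝ) 1 ∧
      (K ≤ (univ.filter fun i => P i j ≤ phMed (fStar n) P t j).card) ∧
      (n ≤ K + (univ.filter fun i => phMed (fStar n) P t j ≤ P i j).card) ∧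
      (phMed (fStar n) P t j < x →
        K + 1 ≤ (univ.filter fun i => P i j ≤ phMed (fStar n) P t j).card) ∧
      (x < phMed (fStar n) P t j →
        n + 1 ≤ K + (univ.filter fun i => phMed (fStar n) P t j ≤ P i j).card) := by
  obtain ⟨K, hKn, hK1, hK2⟩ : ∃ K : ℕ, K ≤ n ∧ (K:ℝ) ≤ t * (n+1) ∧ t * (n+1) ≤ K + 1 := by
    have hs0 : 0 ≤ t * ((n:ℝ)+1) := mul_nonneg ht.1 (by positivity)
    rcases lt_or_ge (t * ((n:ℝ)+1)) n with h | h
    · refine ⟨⌊t * ((n:ℝ)+1)⌋₊, ?_, Nat.floor_le hs0, (Nat.lt_floor_add_one _).le⟩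
      exact Nat.floor_le_of_le h.le
    · refine ⟨n, le_rfl, h, ?_⟩
      nlinarith [ht.2, Nat.cast_nonneg (α := ℝ) n]
  refine ⟨K, t * (n+1) - K, by linarith, hKn, fun j => ?_⟩
  have ha : phMed (fStar n) P t j ∈ Set.Icc (0:ℝ) 1 :=
    ⟨aux_lower _ _ _ _ _ (fun k => (aux_fStar_mem n k t).1),
      aux_upper _ _ _ _ _ (fun k => (aux_fStar_mem n k t).2)⟩
  obtain ⟨g1, g2⟩ := aux_phMed (fStar n) P t j
  generalize phMed (fStar n) P t j = a at *
  have c1 := aux_compl n (fun i => P i j) a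
  have c2 := aux_compl2 n (fun i => P i j) a
  have kc : ∀ k l : ℕ, k + 1 ≤ l → (k:ℝ) + 1 ≤ l := fun k l h => by exact_mod_cast h
  refine ⟨ha, ?_, ?_, ?_, ?_⟩
  · rcases lt_or_eq_of_le ha.2 with h | h
    · have : (univ.filter fun k : Fin (n+1) => k < (⟨K, by omega⟩ : Fin (n+1))).card ≤
          (univ.filter fun k => a < fStar n k t).card := by
        apply Finset.card_le_card
        intro k
        simp only [Finset.mem_filter, Finset.mem_univ, true_and]
        intro hk
        have hk' := kc k K (Nat.succ_le_of_lt hk)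
        unfold fStar
        exact lt_max_of_lt_right (lt_min h (by linarith))
      rw [Finset.filter_gt_eq_Iio, Fin.card_Iio] at this
      simp only at this
      omega
    · rw [Finset.filter_true_of_mem]
      · simpa using hKn
      · intro i _
        rw [h]; exact ((hP i).1 j).2
  · rcases lt_or_eq_of_le ha.1 with h | h
    · have : (univ.filter fun k : Fin (n+1) => (⟨K, by omega⟩ : Fin (n+1)) < k).card ≤
          (univ.filter fun k => fStar n k t < a).card := by
        apply Finset.card_le_card
        intro k
        simp only [Finset.mem_filter, Finset.mem_univ, true_and]
        intro hk
        have hk' := kc K k (Nat.succ_le_of_lt hk)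
        unfold fStar
        exact max_lt h (min_lt_of_right_lt (by linarith))
      rw [Finset.filter_lt_eq_Ioi, Fin.card_Ioi] at this
      simp only at this
      omega
    · rw [Finset.filter_true_of_mem]
      · simp
      · intro i _
        rw [← h]; exact ((hP i).1 j).1
  · intro h
    have : (univ.filter fun k : Fin (n+1) => k ≤ (⟨K, by omega⟩ : Fin (n+1))).card ≤
        (univ.filter fun k => a < fStar n k t).card := by
      apply Finset.card_le_card
      intro k
      simp only [Finset.mem_filter, Finset.mem_univ, true_and]
      intro hk
      have hk' : (k:ℝ) ≤ K := Nat.cast_le.2 hk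
      unfold fStar
      exact lt_max_of_lt_right (lt_min (by linarith) (by linarith))
    rw [Finset.filter_ge_eq_Iic, Fin.card_Iic] at this
    simp only at this
    omega
  · intro h
    have : (univ.filter fun k : Fin (n+1) => (⟨K, by omega⟩ : Fin (n+1)) ≤ k).card ≤
        (univ.filter fun k => fStar n k t < a).card := by
      apply Finset.card_le_card
      intro k
      simp only [Finset.mem_filter, Finset.mem_univ, true_and]
      intro hk
      have hk' : (K:ℝ) ≤ k := Nat.cast_le.2 hk
      unfold fStar
      exact max_lt (by linarith) (min_lt_of_right_lt (by linarith))
    rw [Finset.filter_le_eq_Ici, Fin.card_Ici] at this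
    simp only at this
    omega

lemma aux_up {n : ℕ} (v : Fin n → ℝ) (a q : ℝ) (h : a ≤ q) :
    ∑ i, |v i - a| + (2 * (univ.filter fun i => v i ≤ a).card - n) * (q - a) ≤ ∑ i, |v i - q| := by
  have e : (∑ i, ((if v i ≤ a then (2:ℝ) else 0) - 1)) =
      (2 * (univ.filter fun i => v i ≤ a).card - n) := by
    rw [Finset.sum_sub_distrib, ← Finset.sum_filter]
    simp [mul_comm]
  rw [← e, Finset.sum_mul, ← Finset.sum_add_distrib]
  apply Finset.sum_le_sum
  intro i _
  split_ifs with hi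
  · rw [abs_of_nonpos (by linarith), abs_of_nonpos (by linarith)]; linarith
  · rw [abs_of_pos (by linarith)]; linarith [le_abs_self (v i - q)]

lemma aux_down {n : ℕ} (v : Fin n → ℝ) (a q : ℝ) (h : q ≤ a) :
    ∑ i, |v i - a| + (2 * (univ.filter fun i => a ≤ v i).card - n) * (a - q) ≤ ∑ i, |v i - q| := by
  have := aux_up (fun i => - v i) (-a) (-q) (by linarith)
  have e : ∀ x y : ℝ, |-x - -y| = |x - y| := fun x y => by rw [← abs_neg]; ring_nf
  simp only [e, neg_le_neg_iff] at this
  linarith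

lemma aux_ent (a q x : ℝ) (ha : 0 ≤ a) (hq : 0 ≤ q) (hx : 0 < x) (h1 : a < x → q ≤ a)
    (h2 : x < a → a ≤ q) :
    a * Real.log a + (Real.log x + 1) * (q - a) ≤ q * Real.log q ∧
    (q ≠ a → a * Real.log a + (Real.log x + 1) * (q - a) < q * Real.log q) := by
  by_cases hne : q = a
  · subst hne; simp
  suffices a * Real.log a + (Real.log x + 1) * (q - a) < q * Real.log q from ⟨this.le, fun _ => this⟩
  rcases ha.eq_or_lt with h | ha
  · exact absurd (le_antisymm (h1 (by linarith)) (by linarith)) hne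
  have k1 : (Real.log x - Real.log a) * (q - a) ≤ 0 := by
    rcases lt_trichotomy a x with h | h | h
    · have := Real.log_lt_log ha h
      exact mul_nonpos_of_nonneg_of_nonpos (by linarith) (by linarith [h1 h])
    · simp [h]
    · have := Real.log_lt_log hx h
      exact mul_nonpos_of_nonpos_of_nonneg (by linarith) (by linarith [h2 h])
  have k2 : a * Real.log a + (Real.log a + 1) * (q - a) < q * Real.log q := by
    rcases hq.eq_or_lt with h | hq
    · rw [← h]; simp; linarith
    · have := Real.log_lt_sub_one_of_pos (x := a / q) (by positivity)
        (by rw [Ne, div_eq_one_iff_eq hq.ne']; exact fun h => hne h.symm)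
      rw [Real.log_div ha.ne' hq.ne'] at this
      have h3 := mul_lt_mul_of_pos_left this hq
      have h4 : q * (a / q - 1) = a - q := by field_simp
      nlinarith
  nlinarith

/-- `A^{F*}(P)` is the unique Shannon-entropy maximizer among all budget
divisions maximizing social welfare for `P`. -/
theorem fstar_max_entropy (n m : ℕ) (hn : 1 ≤ n) (hm : 2 ≤ m)
    (P : Fin n → Fin m → ℝ) (hP : IsProfile P) :
    MaximizesWelfare P (AMP (fStar n) P) ∧
    ∀ q : Fin m → ℝ, MaximizesWelfare P q → q ≠ AMP (fStar n) P →
      -∑ j, q j * Real.log (q j) <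
        -∑ j, AMP (fStar n) P j * Real.log (AMP (fStar n) P j) := by
  obtain ⟨ht, hsum⟩ := aux_tStar (n := n) hm P
  obtain ⟨K, x, hx0, hKn, hst⟩ := aux_struct P hP _ ht
  change ∀ j, AMP (fStar n) P j ∈ Set.Icc (0:ℝ) 1 ∧
      (K ≤ (univ.filter fun i => P i j ≤ AMP (fStar n) P j).card) ∧
      (n ≤ K + (univ.filter fun i => AMP (fStar n) P j ≤ P i j).card) ∧
      (AMP (fStar n) P j < x →
        K + 1 ≤ (univ.filter fun i => P i j ≤ AMP (fStar n) P j).card) ∧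
      (x < AMP (fStar n) P j →
        n + 1 ≤ K + (univ.filter fun i => AMP (fStar n) P j ≤ P i j).card) at hst
  generalize AMP (fStar n) P = a at *
  have hdiv : IsDivision a := ⟨fun j => (hst j).1, hsum⟩
  have hswap : ∀ q : Fin m → ℝ, ∑ i, l1 (P i) q = ∑ j, ∑ i, |P i j - q j| := by
    intro q
    unfold l1
    exact Finset.sum_comm
  -- supporting line inequality
  have hsupp : ∀ (q : Fin m → ℝ) j,
      ∑ i, |P i j - a j| + (2 * (K:ℝ) - n) * (q j - a j) ≤ ∑ i, |P i j - q j| := by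
    intro q j
    obtain ⟨-, b1, b2, -, -⟩ := hst j
    have b1' : (K:ℝ) ≤ (univ.filter fun i => P i j ≤ a j).card := by exact_mod_cast b1
    have b2' : (n:ℝ) ≤ K + (univ.filter fun i => a j ≤ P i j).card := by exact_mod_cast b2
    rcases le_total (a j) (q j) with h | h
    · have := aux_up (fun i => P i j) _ _ h
      nlinarith [mul_nonneg (sub_nonneg.2 h) (sub_nonneg.2 b1')]
    · have := aux_down (fun i => P i j) _ _ h
      nlinarith [mul_nonneg (sub_nonneg.2 h) (sub_nonneg.2 b2')]
  have hlin : ∀ q : Fin m → ℝ, IsDivision q →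
      ∑ j, (∑ i, |P i j - a j| + (2 * (K:ℝ) - n) * (q j - a j)) = ∑ i, l1 (P i) a := by
    intro q hq
    rw [Finset.sum_add_distrib, ← Finset.mul_sum, Finset.sum_sub_distrib, hq.2, hsum, hswap]
    simp
  refine ⟨⟨hdiv, fun q hq => ?_⟩, fun q hq hne => ?_⟩
  · rw [← hlin q hq, hswap q]
    exact Finset.sum_le_sum fun j _ => hsupp q j
  · have heq : ∀ j, ∑ i, |P i j - a j| + (2 * (K:ℝ) - n) * (q j - a j) = ∑ i, |P i j - q j| := by
      have h1 : ∑ j, (∑ i, |P i j - a j| + (2 * (K:ℝ) - n) * (q j - a j)) =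
          ∑ j, ∑ i, |P i j - q j| := by
        apply le_antisymm
        · exact Finset.sum_le_sum fun j _ => hsupp q j
        · rw [hlin q hq.1, ← hswap]
          exact hq.2 a hdiv
      intro j
      exact (Finset.sum_eq_sum_iff_of_le (fun j _ => hsupp q j)).1 h1 j (Finset.mem_univ j)
    have hlt : ∀ j, a j < x → q j ≤ a j := by
      intro j hj
      by_contra! h
      have b1 := (hst j).2.2.2.1 hj
      have b1' : (K:ℝ) + 1 ≤ (univ.filter fun i => P i j ≤ a j).card := by exact_mod_cast b1
      have := aux_up (fun i => P i j) _ _ h.le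
      nlinarith [heq j, mul_nonneg (sub_nonneg.2 h.le) (sub_nonneg.2 b1')]
    have hgt : ∀ j, x < a j → a j ≤ q j := by
      intro j hj
      by_contra! h
      have b1 := (hst j).2.2.2.2 hj
      have b1' : (n:ℝ) + 1 ≤ K + (univ.filter fun i => a j ≤ P i j).card := by exact_mod_cast b1
      have := aux_down (fun i => P i j) _ _ h.le
      nlinarith [heq j, mul_nonneg (sub_nonneg.2 h.le) (sub_nonneg.2 b1')]
    have hx : 0 < x := by
      rcases hx0.eq_or_lt with h | h
      · exfalso
        apply hne
        have hle : ∀ j, a j ≤ q j := by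
          intro j
          rcases (hst j).1.1.eq_or_lt with h' | h'
          · rw [← h']; exact (hq.1.1 j).1
          · exact hgt j (by rw [← h]; exact h')
        have h1 : ∑ j, a j = ∑ j, q j := by rw [hsum, hq.1.2]
        funext j
        exact ((Finset.sum_eq_sum_iff_of_le (fun j _ => hle j)).1 h1 j (Finset.mem_univ j)).symm
      · exact h
    have hent := fun j => aux_ent (a j) (q j) x (hst j).1.1 (hq.1.1 j).1 hx (hlt j) (hgt j)
    obtain ⟨j0, hj0⟩ := Function.ne_iff.1 hne
    have hfin : ∑ j, (a j * Real.log (a j) + (Real.log x + 1) * (q j - a j)) <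
        ∑ j, q j * Real.log (q j) :=
      Finset.sum_lt_sum (fun j _ => (hent j).1) ⟨j0, Finset.mem_univ _, (hent j0).2 hj0⟩
    rw [Finset.sum_add_distrib, ← Finset.mul_sum, Finset.sum_sub_distrib, hq.1.2, hsum] at hfin
    linarith
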